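/- arXiv:1608.05627 — 6 statements merged into one kernel-verified Lean document; each statement's English description precedes it below -/
import Mathlib

section
/- Equip ℤ³ with the symmetric bilinear form ⟨(r₁,c₁,m₁),(r₂,c₂,m₂)⟩ = 132c₁c₂ − r₁m₂ − r₂m₁ and let v = (4,1,16). Then there is no nonzero a = (s,t,u) ∈ ℤ³ such that −2 ≤ ⟨a,a⟩ < 1 and 0 ≤ ⟨v,a⟩ ≤ 2; explicitly, there is no nonzero (s,t,u) ∈ ℤ³ with −2 ≤ 132t² − 2su < 1 and 0 ≤ 132t − 16s − 4u ≤ 2. -/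
/-- The Mukai pairing on `ℤ³ = H⁰ ⊕ ℤh ⊕ H⁴` for a K3 surface with `NS(S) = ℤh`,
`h² = 132`: `⟨(r₁,c₁,m₁),(r₂,c₂,m₂)⟩ = 132c₁c₂ − r₁m₂ − r₂m₁`. -/
def mukai132 (a b : ℤ × ℤ × ℤ) : ℤ :=
  132 * a.2.1 * b.2.1 - a.1 * b.2.2 - b.1 * a.2.2

/-- The Mukai vector `v = (4, h, 16)`. -/
def v132 : ℤ × ℤ × ℤ := (4, 1, 16)

theorem aux132 (s t u : ℤ) (h1 : -2 ≤ 132 * t ^ 2 - 2 * s * u)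
    (h2 : 132 * t ^ 2 - 2 * s * u < 1)
    (h3 : 0 ≤ 132 * t - 16 * s - 4 * u) (h4 : 132 * t - 16 * s - 4 * u ≤ 2) :
    s = 0 ∧ t = 0 ∧ u = 0 := by
  have hu : u = 33 * t - 4 * s := by omega
  have h5 : s * u = 66 * t ^ 2 ∨ s * u = 66 * t ^ 2 + 1 := by
    rw [mul_assoc] at h1 h2
    omega
  subst hu
  rcases h5 with h | h
  · have hx : (8 * s - 33 * t) ^ 2 = 33 * t ^ 2 := by linarith
    have ht : t = 0 := by
      by_contra ht
      have hd : t ^ 2 ∣ (8 * s - 33 * t) ^ 2 := ⟨33, by linarith⟩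
      obtain ⟨k, hk⟩ := (Int.pow_dvd_pow_iff two_ne_zero).1 hd
      rw [hk] at hx
      have ht2 : t ^ 2 ≠ 0 := pow_ne_zero 2 ht
      have hk2 : k ^ 2 = 33 := mul_left_cancel₀ ht2 (by linarith)
      have : k < 6 := by nlinarith
      have : -6 < k := by nlinarith
      interval_cases k <;> omega
    subst ht
    have : s = 0 := by
      have : s ^ 2 = 0 := by linarith
      exact pow_eq_zero_iff two_ne_zero |>.1 this
    subst this
    simp
  · exfalso
    have hx : (8 * s - 33 * t) ^ 2 = 33 * t ^ 2 - 16 := by linarith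
    generalize 8 * s - 33 * t = x at hx
    have h3 : x ^ 2 % 3 = 2 := by omega
    have : x % 3 = 0 ∨ x % 3 = 1 ∨ x % 3 = 2 := by omega
    rcases this with h | h | h <;> simp [pow_two, Int.mul_emod, h] at h3

/-- There is no nonzero `a = (s,t,u) ∈ ℤ³` with `−2 ≤ ⟨a,a⟩ < 1` and `0 ≤ ⟨v,a⟩ ≤ 2`;
explicitly, there is no nonzero `(s,t,u)` with `−2 ≤ 132t² − 2su < 1` and
`0 ≤ 132t − 16s − 4u ≤ 2`. -/
theorem stmt_2 :
    (¬ ∃ a : ℤ × ℤ × ℤ, a ≠ 0 ∧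
      -2 ≤ mukai132 a a ∧ mukai132 a a < 1 ∧
      0 ≤ mukai132 v132 a ∧ mukai132 v132 a ≤ 2) ∧
    (¬ ∃ s t u : ℤ, (s, t, u) ≠ (0, 0, 0) ∧
      -2 ≤ 132 * t ^ 2 - 2 * s * u ∧ 132 * t ^ 2 - 2 * s * u < 1 ∧
      0 ≤ 132 * t - 16 * s - 4 * u ∧ 132 * t - 16 * s - 4 * u ≤ 2) := by
  constructor
  · rintro ⟨⟨s, t, u⟩, hne, h1, h2, h3, h4⟩
    simp only [mukai132, v132] at h1 h2 h3 h4
    obtain ⟨rfl, rfl, rfl⟩ := aux132 s t u (by linarith) (by linarith) (by linarith) (by linarith)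
    exact hne rfl
  · rintro ⟨s, t, u, hne, h1, h2, h3, h4⟩
    obtain ⟨rfl, rfl, rfl⟩ := aux132 s t u h1 h2 h3 h4
    exact hne rfl
end

section
/- Equip ℤ³ with the symmetric bilinear form ⟨(r₁,c₁,m₁),(r₂,c₂,m₂)⟩ = 510c₁c₂ − r₁m₂ − r₂m₁ and let v = (6,1,42). Then there is no nonzero a = (s,t,u) ∈ ℤ³ such that −2 ≤ ⟨a,a⟩ and 2⟨a,a⟩ < 3 and 0 ≤ ⟨v,a⟩ ≤ 3; explicitly, there is no nonzero (s,t,u) ∈ ℤ³ with −2 ≤ 510t² − 2su, 2(510t² − 2su) < 3, and 0 ≤ 510t − 42s − 6u ≤ 3. -/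
/-- The Mukai pairing on `ℤ³` for a K3 surface with `NS(S) = ℤh`, `h² = 510`:
`⟨(r₁,c₁,m₁),(r₂,c₂,m₂)⟩ = 510c₁c₂ − r₁m₂ − r₂m₁`. -/
def mukai510 (a b : ℤ × ℤ × ℤ) : ℤ :=
  510 * a.2.1 * b.2.1 - a.1 * b.2.2 - b.1 * a.2.2

/-- The Mukai vector `v = (6, h, 42)`. -/
def v510 : ℤ × ℤ × ℤ := (6, 1, 42)

theorem aux510 (s t u : ℤ) (h1 : -2 ≤ 510 * t ^ 2 - 2 * s * u)
    (h2 : 2 * (510 * t ^ 2 - 2 * s * u) < 3)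
    (h3 : 0 ≤ 510 * t - 42 * s - 6 * u) (h4 : 510 * t - 42 * s - 6 * u ≤ 3) :
    s = 0 ∧ t = 0 ∧ u = 0 := by
  have hu : u = 85 * t - 7 * s := by omega
  subst hu
  obtain ⟨q, hq⟩ : ∃ q : ℤ, q = 255 * t ^ 2 - s * (85 * t - 7 * s) := ⟨_, rfl⟩
  have hq1 : -1 ≤ q := by linarith
  have hq2 : q < 1 := by linarith
  have key : (14 * s - 85 * t) ^ 2 - 85 * t ^ 2 = 28 * q := by rw [hq]; ring
  obtain ⟨x, hx⟩ : ∃ x : ℤ, x = 14 * s - 85 * t := ⟨_, rfl⟩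
  rw [← hx] at key
  have hc : q = -1 ∨ q = 0 := by omega
  rcases hc with h | h
  · exfalso
    rw [h] at key
    have hm : x % 5 = 0 ∨ x % 5 = 1 ∨ x % 5 = 2 ∨ x % 5 = 3 ∨ x % 5 = 4 := by omega
    have h5 : x ^ 2 % 5 = 2 := by omega
    rcases hm with h | h | h | h | h <;> simp [pow_two, Int.mul_emod, h] at h5
  · rw [h] at key
    have ht : t = 0 := by
      by_contra ht
      have hd : t ^ 2 ∣ x ^ 2 := ⟨85, by linarith⟩
      rw [Int.pow_dvd_pow_iff (by norm_num)] at hd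
      obtain ⟨k, rfl⟩ := hd
      have hk : k ^ 2 = 85 := by
        have : t ^ 2 * (k ^ 2 - 85) = 0 := by linarith [mul_pow t k 2]
        rcases mul_eq_zero.mp this with h | h
        · exact absurd (pow_eq_zero_iff (by norm_num) |>.mp h) ht
        · linarith
      have b1 : k < 10 := by nlinarith
      have b2 : -10 < k := by nlinarith
      interval_cases k <;> omega
    subst ht
    have : x = 0 := by
      apply pow_eq_zero_iff (n := 2) (by norm_num) |>.mp
      linarith
    omega

/-- There is no nonzero `a = (s,t,u) ∈ ℤ³` with `−2 ≤ ⟨a,a⟩`, `2⟨a,a⟩ < 3` and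
`0 ≤ ⟨v,a⟩ ≤ 3`; explicitly, there is no nonzero `(s,t,u)` with `−2 ≤ 510t² − 2su`,
`2(510t² − 2su) < 3`, and `0 ≤ 510t − 42s − 6u ≤ 3`. -/
theorem stmt_5 :
    (¬ ∃ a : ℤ × ℤ × ℤ, a ≠ 0 ∧
      -2 ≤ mukai510 a a ∧ 2 * mukai510 a a < 3 ∧
      0 ≤ mukai510 v510 a ∧ mukai510 v510 a ≤ 3) ∧
    (¬ ∃ s t u : ℤ, (s, t, u) ≠ (0, 0, 0) ∧
      -2 ≤ 510 * t ^ 2 - 2 * s * u ∧ 2 * (510 * t ^ 2 - 2 * s * u) < 3 ∧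
      0 ≤ 510 * t - 42 * s - 6 * u ∧ 510 * t - 42 * s - 6 * u ≤ 3) := by
  refine ⟨?_, ?_⟩
  · rintro ⟨⟨s, t, u⟩, hne, h1, h2, h3, h4⟩
    simp only [mukai510, v510] at h1 h2 h3 h4
    obtain ⟨rfl, rfl, rfl⟩ := aux510 s t u (by linarith) (by linarith) (by linarith) (by linarith)
    exact hne rfl
  · rintro ⟨s, t, u, hne, h1, h2, h3, h4⟩
    obtain ⟨rfl, rfl, rfl⟩ := aux510 s t u h1 h2 h3 h4
    exact hne rfl
end

section
/- There do not exist integers x, y such that 9x² − 145xy + 580y² = −1. -/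
theorem aux_sq (m n u : ℤ) (h : IsCoprime n m) (e : n * m = u ^ 2)
    (hn : n % 5 = 2 ∨ n % 5 = 3) : False := by
  obtain ⟨s, hs⟩ := Int.sq_of_isCoprime h e
  have h5 : s % 5 = 0 ∨ s % 5 = 1 ∨ s % 5 = 2 ∨ s % 5 = 3 ∨ s % 5 = 4 := by omega
  have h2 : s ^ 2 % 5 = 0 ∨ s ^ 2 % 5 = 1 ∨ s ^ 2 % 5 = 4 := by
    rcases h5 with h | h | h | h | h <;> simp [pow_two, Int.mul_emod, h]
  omega

theorem aux_main (a u : ℤ) (ha : a % 2 = 1) (h : (a - 4) * (a + 4) = 145 * u ^ 2) : False := by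
  have hc : IsCoprime (a - 4) (a + 4) := by
    have h1 : IsCoprime (a - 4) (2 ^ 3) := by
      apply IsCoprime.pow_right
      exact ⟨1, -((a - 5) / 2), by omega⟩
    have h2 := h1.add_mul_left_right 1
    have e : (2 : ℤ) ^ 3 + (a - 4) * 1 = a + 4 := by ring
    rwa [e] at h2
  have p5 : Prime (5 : ℤ) := by norm_num
  have p29 : Prime (29 : ℤ) := by norm_num
  have d5 : (5 : ℤ) ∣ (a - 4) * (a + 4) := ⟨29 * u ^ 2, by rw [h]; ring⟩
  have d29 : (29 : ℤ) ∣ (a - 4) * (a + 4) := ⟨5 * u ^ 2, by rw [h]; ring⟩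
  rcases p5.dvd_or_dvd d5 with h5 | h5 <;> rcases p29.dvd_or_dvd d29 with h29 | h29
  · obtain ⟨m, hm⟩ : (145 : ℤ) ∣ a - 4 := by omega
    refine aux_sq m (a + 4) u (hc.symm.of_isCoprime_of_dvd_right ⟨145, by linarith⟩) ?_ (by omega)
    rw [hm] at h; linarith
  · obtain ⟨m, hm⟩ := h5
    obtain ⟨n, hn⟩ := h29
    refine aux_sq m n u ((hc.symm.of_isCoprime_of_dvd_right ⟨5, by linarith⟩).of_isCoprime_of_dvd_left ⟨29, by linarith⟩) ?_ (by omega)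
    rw [hm, hn] at h; linarith
  · obtain ⟨m, hm⟩ := h5
    obtain ⟨n, hn⟩ := h29
    refine aux_sq m n u ((hc.of_isCoprime_of_dvd_right ⟨5, by linarith⟩).of_isCoprime_of_dvd_left ⟨29, by linarith⟩) ?_ (by omega)
    rw [hm, hn] at h; linarith
  · obtain ⟨m, hm⟩ : (145 : ℤ) ∣ a + 4 := by omega
    refine aux_sq m (a - 4) u (hc.of_isCoprime_of_dvd_right ⟨145, by linarith⟩) ?_ (by omega)
    rw [hm] at h; linarith

/-- There do not exist integers `x`, `y` such that `9x² − 145xy + 580y² = −1`. -/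
theorem stmt_7 : ¬ ∃ x y : ℤ, 9 * x ^ 2 - 145 * x * y + 580 * y ^ 2 = -1 := by
  rintro ⟨x, y, h⟩
  have hu : (x - 8 * y) % 2 = 1 := by
    by_contra hx
    obtain ⟨k, hk⟩ : (2 : ℤ) ∣ x := by omega
    have : 2 * (18 * k ^ 2 - 145 * k * y + 290 * y ^ 2) = -1 := by rw [hk] at h; linarith
    omega
  refine aux_main (8 * y + (x - 8 * y)) (x - 8 * y) (by omega) ?_
  linear_combination (-16) * h
end

section
/- Equip ℤ³ with the symmetric bilinear form ⟨(r₁,c₁,m₁),(r₂,c₂,m₂)⟩ = 1160c₁c₂ − r₁m₂ − r₂m₁ and let v = (8,1,72). Then there is no nonzero a = (s,t,u) ∈ ℤ³ such that −2 ≤ ⟨a,a⟩ < 2 and 0 ≤ ⟨v,a⟩ ≤ 4; explicitly, there is no nonzero (s,t,u) ∈ ℤ³ with −2 ≤ 1160t² − 2su < 2 and 0 ≤ 1160t − 72s − 8u ≤ 4. -/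
/-- The Mukai pairing on `ℤ³` for a K3 surface with `NS(S) = ℤh`, `h² = 1160`:
`⟨(r₁,c₁,m₁),(r₂,c₂,m₂)⟩ = 1160c₁c₂ − r₁m₂ − r₂m₁`. -/
def mukai1160 (a b : ℤ × ℤ × ℤ) : ℤ :=
  1160 * a.2.1 * b.2.1 - a.1 * b.2.2 - b.1 * a.2.2

/-- The Mukai vector `v = (8, h, 72)`. -/
def v1160 : ℤ × ℤ × ℤ := (8, 1, 72)

theorem descent_aux (n : ℕ) : ∀ x y : ℤ, y.natAbs = n →
    -1 ≤ 9 * x ^ 2 - x * y - 4 * y ^ 2 → 9 * x ^ 2 - x * y - 4 * y ^ 2 ≤ 1 → x = 0 ∧ y = 0 := by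
  induction n using Nat.strong_induction_on with
  | _ n ih =>
    intro x y hy h1 h2
    have hz1 : 145 * y ^ 2 - 36 ≤ (18 * x - y) ^ 2 := by nlinarith
    have hz2 : (18 * x - y) ^ 2 ≤ 145 * y ^ 2 + 36 := by nlinarith
    by_cases hs : y.natAbs ≤ 1
    · have hb : -1 ≤ y ∧ y ≤ 1 := by omega
      obtain ⟨hb1, hb2⟩ := hb
      have hx1 : x ≤ 1 := by nlinarith
      have hx2 : -1 ≤ x := by nlinarith
      interval_cases y <;> interval_cases x <;> simp_all
    · have hy2 : 2 ^ 2 ≤ y ^ 2 := by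
        apply sq_le_sq.mpr
        rw [Int.abs_eq_natAbs, Int.abs_eq_natAbs]
        omega
      have a1 : |11 * y| < |18 * x - y| := sq_lt_sq.mp (by nlinarith)
      have a2 : |18 * x - y| < |13 * y| := sq_lt_sq.mp (by nlinarith)
      rw [Int.abs_eq_natAbs, Int.abs_eq_natAbs] at a1 a2
      have hc : (18 * x - 13 * y).natAbs < n ∨ (18 * x + 11 * y).natAbs < n := by omega
      rcases hc with hc | hc
      · have := ih _ hc (-11 * x + 8 * y) (18 * x - 13 * y) rfl (by nlinarith) (by nlinarith)
        omega
      · have := ih _ hc (13 * x + 8 * y) (18 * x + 11 * y) rfl (by nlinarith) (by nlinarith)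
        omega

theorem explicit_aux (s t u : ℤ) (h1 : -2 ≤ 1160 * t ^ 2 - 2 * s * u)
    (h2 : 1160 * t ^ 2 - 2 * s * u < 2) (h3 : 0 ≤ 1160 * t - 72 * s - 8 * u)
    (h4 : 1160 * t - 72 * s - 8 * u ≤ 4) : s = 0 ∧ t = 0 ∧ u = 0 := by
  have hu : u = 145 * t - 9 * s := by omega
  subst hu
  have := descent_aux _ (s - 8 * t) t rfl (by nlinarith) (by nlinarith)
  omega

/-- There is no nonzero `a = (s,t,u) ∈ ℤ³` with `−2 ≤ ⟨a,a⟩ < 2` and `0 ≤ ⟨v,a⟩ ≤ 4`;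
explicitly, there is no nonzero `(s,t,u)` with `−2 ≤ 1160t² − 2su < 2` and
`0 ≤ 1160t − 72s − 8u ≤ 4`. -/
theorem stmt_8 :
    (¬ ∃ a : ℤ × ℤ × ℤ, a ≠ 0 ∧
      -2 ≤ mukai1160 a a ∧ mukai1160 a a < 2 ∧
      0 ≤ mukai1160 v1160 a ∧ mukai1160 v1160 a ≤ 4) ∧
    (¬ ∃ s t u : ℤ, (s, t, u) ≠ (0, 0, 0) ∧
      -2 ≤ 1160 * t ^ 2 - 2 * s * u ∧ 1160 * t ^ 2 - 2 * s * u < 2 ∧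
      0 ≤ 1160 * t - 72 * s - 8 * u ∧ 1160 * t - 72 * s - 8 * u ≤ 4) := by
  constructor
  · rintro ⟨⟨s, t, u⟩, h0, h1, h2, h3, h4⟩
    simp only [mukai1160, v1160] at h1 h2 h3 h4
    obtain ⟨rfl, rfl, rfl⟩ := explicit_aux s t u (by nlinarith) (by nlinarith)
      (by linarith) (by linarith)
    exact h0 rfl
  · rintro ⟨s, t, u, h0, h1, h2, h3, h4⟩
    obtain ⟨rfl, rfl, rfl⟩ := explicit_aux s t u h1 h2 h3 h4
    exact h0 rfl
end

section
/- There do not exist integers x, y such that 9x² − 145xy + 580y² = 1. -/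
theorem aux_descent (n : ℕ) : ∀ w x : ℤ, 0 ≤ w → 0 ≤ x → x.toNat = n → x % 2 = 1 →
    (w ^ 2 - 145 * x ^ 2 = 16 ∨ w ^ 2 - 145 * x ^ 2 = -16) → False := by
  induction n using Nat.strong_induction_on with
  | _ n ih =>
    intro w x hw hx hn hodd h
    have hx1 : 1 ≤ x := by omega
    have hwodd : w % 2 = 1 := by
      rcases Int.emod_two_eq_zero_or_one w with h0 | h1
      · exfalso
        obtain ⟨a, rfl⟩ : ∃ a, w = 2 * a := ⟨w / 2, by omega⟩
        obtain ⟨b, rfl⟩ : ∃ b, x = 2 * b + 1 := ⟨x / 2, by omega⟩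
        ring_nf at h
        omega
      · exact h1
    have hlt : |w - 12 * x| < x := by
      rw [abs_lt]
      constructor <;> rcases h with h | h <;> nlinarith
    refine ih (|w - 12 * x|).toNat (by have := abs_nonneg (w - 12 * x); omega)
      (|145 * x - 12 * w|) (|w - 12 * x|) (abs_nonneg _) (abs_nonneg _) rfl ?_ ?_
    · rcases abs_choice (w - 12 * x) with e | e <;> rw [e] <;> omega
    · rw [sq_abs, sq_abs]
      rcases h with h | h
      · right; linear_combination (-1) * h
      · left; linear_combination (-1) * h

/-- There do not exist integers `x`, `y` such that `9x² − 145xy + 580y² = 1`. -/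
theorem stmt_10 : ¬ ∃ x y : ℤ, 9 * x ^ 2 - 145 * x * y + 580 * y ^ 2 = 1 := by
  rintro ⟨x, y, h⟩
  have hodd : x % 2 = 1 := by
    rcases Int.emod_two_eq_zero_or_one x with h0 | h1
    · exfalso
      obtain ⟨a, rfl⟩ : ∃ a, x = 2 * a := ⟨x / 2, by omega⟩
      ring_nf at h
      omega
    · exact h1
  refine aux_descent _ (|x|) (|x - 8 * y|) (abs_nonneg _) (abs_nonneg _) rfl ?_ ?_
  · rcases abs_choice (x - 8 * y) with e | e <;> rw [e] <;> omega
  · rw [sq_abs, sq_abs]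
    right
    linear_combination (-16) * h
end

section
/- Fix an integer d ≥ 1. Equip ℚ³ with the symmetric bilinear form B((r₁,c₁,m₁),(r₂,c₂,m₂)) = 2d·c₁c₂ − r₁m₂ − r₂m₁. Let δ₁ = (1,0,1) and δ₂ = (d+1, d, d²−d+1). Then B(δ₁,δ₁) = −2 and B(δ₂,δ₂) = −2, and the composition f = s₁ ∘ s₂ of the reflections sᵢ(x) = x + B(x,δᵢ)δᵢ is a linear endomorphism of ℚ³ whose characteristic polynomial equals (X − 1)(X² − (d⁴ + 4d² + 2)X + 1). -/
open Polynomial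

/-- The Mukai pairing on `ℚ³`, for a K3 surface with ample divisor `h`, `h² = 2d`:
`B((r₁,c₁,m₁),(r₂,c₂,m₂)) = 2d·c₁c₂ − r₁m₂ − r₂m₁`. -/
def mukaiForm (d : ℤ) (a b : Fin 3 → ℚ) : ℚ :=
  2 * (d : ℚ) * a 1 * b 1 - a 0 * b 2 - b 0 * a 2

/-- The `(−2)`-class `δ₁ = (1, 0, 1)`. -/
def delta1 : Fin 3 → ℚ := ![1, 0, 1]

/-- The `(−2)`-class `δ₂ = (d+1, d, d²−d+1)`. -/
def delta2 (d : ℤ) : Fin 3 → ℚ := ![(d : ℚ) + 1, (d : ℚ), (d : ℚ) ^ 2 - (d : ℚ) + 1]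

/-- The reflection `s(x) = x + B(x,δ)·δ` in a `(−2)`-class `δ`. -/
def reflIn (d : ℤ) (δ : Fin 3 → ℚ) (x : Fin 3 → ℚ) : Fin 3 → ℚ :=
  x + mukaiForm d x δ • δ

/-- For an integer `d ≥ 1`: `B(δ₁,δ₁) = −2`, `B(δ₂,δ₂) = −2`, and the composition
`f = s₁ ∘ s₂` of the reflections in `δ₁` and `δ₂` is a linear endomorphism of `ℚ³`
whose characteristic polynomial is `(X − 1)(X² − (d⁴ + 4d² + 2)X + 1)`. -/
theorem stmt_16 (d : ℤ) (hd : 1 ≤ d) :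
    mukaiForm d delta1 delta1 = -2 ∧
    mukaiForm d (delta2 d) (delta2 d) = -2 ∧
    ∃ f : (Fin 3 → ℚ) →ₗ[ℚ] (Fin 3 → ℚ),
      ⇑f = reflIn d delta1 ∘ reflIn d (delta2 d) ∧
      f.charpoly =
        (X - 1) * (X ^ 2 - C ((d : ℚ) ^ 4 + 4 * (d : ℚ) ^ 2 + 2) * X + 1) := by
  refine ⟨?_, ?_, ?_⟩
  · simp [mukaiForm, delta1]; norm_num
  · simp [mukaiForm, delta2]; ring
  · let r : ℚ := d + 1
    let c : ℚ := d
    let m : ℚ := d ^ 2 - d + 1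
    refine ⟨Matrix.toLin' !![m ^ 2, -(2 * d * c * m), r * m - 1;
      -(c * m), 1 + 2 * d * c ^ 2, -(c * r);
      r * m - 1, -(2 * d * c * r), r ^ 2], ?_, ?_⟩
    · funext x i
      fin_cases i <;>
        simp [reflIn, mukaiForm, delta1, delta2, Matrix.mulVec, dotProduct, Fin.sum_univ_three,
          r, c, m, Matrix.vecHead, Matrix.vecTail] <;> ring
    · rw [Matrix.charpoly_toLin', Matrix.charpoly, Matrix.det_fin_three]
      have h2 : (C 2 : ℚ[X]) = 2 := rfl
      have h4 : (C 4 : ℚ[X]) = 4 := rfl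
      simp [r, c, m, h2, h4]
      ring
end
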